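/- Let N be a weight sequence in the class 𝓛𝓒 satisfying (γ₁) (in particular N is nonquasianalytic). Then N ≈ L^{s,C} for every s ∈ ℕ_{>0} and every real C ≥ 1. -/

import Mathlib

open Filter

noncomputable def nuq (N : ℕ → ℝ) (p : ℕ) : ℝ := N p / N (p - 1)

def IsLC (N : ℕ → ℝ) : Prop :=
  (∀ p, 0 < N p) ∧ N 0 = 1 ∧ N 0 ≤ N 1 ∧
    (∀ p, 1 ≤ p → (N p) ^ 2 ≤ N (p - 1) * N (p + 1)) ∧
    Tendsto (fun p : ℕ => (N p) ^ ((1 : ℝ) / p)) atTop atTop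

def NQA (N : ℕ → ℝ) : Prop := Summable (fun p : ℕ => 1 / nuq N (p + 1))

noncomputable def tailSum (N : ℕ → ℝ) (p : ℕ) : ℝ := ∑' k : ℕ, 1 / nuq N (p + k)

noncomputable def lamSV (M N : ℕ → ℝ) (s p : ℕ) : ℝ :=
  ⨆ j : Fin p, (M p / ((s : ℝ) ^ p * N j)) ^ ((1 : ℝ) / ((p : ℝ) - (j : ℕ)))

def SVcond (M N : ℕ → ℝ) : Prop :=
  ∃ s : ℕ, 1 ≤ s ∧ ∃ B : ℝ, ∀ p : ℕ, 1 ≤ p → lamSV M N s p / p * tailSum N p ≤ B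

noncomputable def Lseq (N : ℕ → ℝ) (s p : ℕ) : ℝ :=
  if p = 0 then 1
  else (s : ℝ) ^ p * ⨅ j : Fin p, ((p : ℝ) / tailSum N p) ^ (p - (j : ℕ)) * N j

noncomputable def LseqC (N : ℕ → ℝ) (s : ℕ) (C : ℝ) (p : ℕ) : ℝ :=
  if p = 0 then 1
  else (s : ℝ) ^ p * ⨅ j : Fin p, (C * p / tailSum N p) ^ (p - (j : ℕ)) * N j

def Preceq (M N : ℕ → ℝ) : Prop :=
  ∃ B : ℝ, ∀ p : ℕ, 1 ≤ p → (M p / N p) ^ ((1 : ℝ) / p) ≤ B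

def SeqEquiv (M N : ℕ → ℝ) : Prop := Preceq M N ∧ Preceq N M

def Gamma1 (N : ℕ → ℝ) : Prop :=
  ∃ B : ℝ, ∀ p : ℕ, 1 ≤ p → nuq N p / p * tailSum N p ≤ B

def MG (N : ℕ → ℝ) : Prop :=
  ∃ C : ℝ, 1 ≤ C ∧ ∀ j k : ℕ, N (j + k) ≤ C ^ (j + k) * N j * N k

noncomputable def tauD (N : ℕ → ℝ) (p : ℕ) : ℝ := p / nuq N p + tailSum N p

noncomputable def sigmaD (N : ℕ → ℝ) (p : ℕ) : ℝ :=
  if p = 0 then 1 else tauD N 1 * p / tauD N p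

noncomputable def Sdesc (N : ℕ → ℝ) (p : ℕ) : ℝ :=
  ∏ i ∈ Finset.range (p + 1), sigmaD N i

def AlmostIncreasing (a : ℕ → ℝ) : Prop :=
  ∃ C : ℝ, 1 ≤ C ∧ ∀ p q : ℕ, 1 ≤ p → p ≤ q → a p ≤ C * a q

noncomputable def BorelMap (f : ℝ → ℂ) : ℕ → ℂ := fun p => iteratedDeriv p f 0

def DRoumieu (N : ℕ → ℝ) : Set (ℝ → ℂ) :=
  {f | ContDiff ℝ (⊤ : ℕ∞) f ∧ Function.support f ⊆ Set.Icc (-1 : ℝ) 1 ∧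
    ∃ C h : ℝ, 0 < C ∧ 0 < h ∧ ∀ p x, ‖iteratedDeriv p f x‖ ≤ C * h ^ p * N p}

def LambdaRoumieu (M : ℕ → ℝ) : Set (ℕ → ℂ) :=
  {a | ∃ C h : ℝ, 0 < C ∧ 0 < h ∧ ∀ p, ‖a p‖ ≤ C * h ^ p * M p}

def DBeurling (N : ℕ → ℝ) : Set (ℝ → ℂ) :=
  {f | ContDiff ℝ (⊤ : ℕ∞) f ∧ Function.support f ⊆ Set.Icc (-1 : ℝ) 1 ∧
    ∀ h : ℝ, 0 < h → ∃ C : ℝ, 0 < C ∧ ∀ p x, ‖iteratedDeriv p f x‖ ≤ C * h ^ p * N p}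

def LambdaBeurling (M : ℕ → ℝ) : Set (ℕ → ℂ) :=
  {a | ∀ h : ℝ, 0 < h → ∃ C : ℝ, 0 < C ∧ ∀ p, ‖a p‖ ≤ C * h ^ p * M p}

lemma nuq_pos {N : ℕ → ℝ} (hpos : ∀ p, 0 < N p) (p : ℕ) : 0 < nuq N p :=
  div_pos (hpos p) (hpos (p - 1))

lemma tailSum_nonneg {N : ℕ → ℝ} (hpos : ∀ p, 0 < N p) (p : ℕ) : 0 ≤ tailSum N p :=
  tsum_nonneg fun k => (one_div_pos.2 (nuq_pos hpos (p + k))).le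

lemma one_div_nuq_le_tailSum {N : ℕ → ℝ} (hpos : ∀ p, 0 < N p) {p : ℕ} (hT : tailSum N p ≠ 0) :
    1 / nuq N p ≤ tailSum N p := by
  have hs : Summable fun k : ℕ => 1 / nuq N (p + k) := by
    by_contra h
    exact hT (tsum_eq_zero_of_not_summable h)
  exact hs.le_tsum 0 fun k _ => (one_div_pos.2 (nuq_pos hpos (p + k))).le

lemma IsLC.nuq_monotone {N : ℕ → ℝ} (hN : IsLC N) : Monotone (nuq N) := by
  obtain ⟨hpos, h0, h01, hlc, -⟩ := hN
  refine monotone_nat_of_le_succ fun p => ?_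
  rcases p with _ | p
  · simpa [nuq, h0] using h01
  · have h := hlc (p + 1) (by omega)
    simp only [nuq, Nat.add_sub_cancel] at h ⊢
    rw [div_le_div_iff₀ (hpos _) (hpos _)]
    nlinarith

lemma IsLC.le_nuq_pow_mul {N : ℕ → ℝ} (hN : IsLC N) (j d : ℕ) :
    N (j + d) ≤ nuq N (j + d) ^ d * N j := by
  have hpos := hN.1
  induction d with
  | zero => simp
  | succ d ih =>
    have hν := nuq_pos hpos
    have hstep : N (j + (d + 1)) = nuq N (j + (d + 1)) * N (j + d) :=
      (div_mul_cancel₀ _ (hpos (j + d)).ne').symm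
    have hmono : nuq N (j + d) ≤ nuq N (j + (d + 1)) := hN.nuq_monotone (by omega)
    calc N (j + (d + 1)) = nuq N (j + (d + 1)) * N (j + d) := hstep
      _ ≤ nuq N (j + (d + 1)) * (nuq N (j + d) ^ d * N j) :=
          mul_le_mul_of_nonneg_left ih (hν _).le
      _ ≤ nuq N (j + (d + 1)) * (nuq N (j + (d + 1)) ^ d * N j) := by
          have := (hν (j + d)).le
          have := (hν (j + (d + 1))).le
          have := (hpos j).le
          gcongr
      _ = nuq N (j + (d + 1)) ^ (d + 1) * N j := by ring

lemma preceq_of_div_le_pow {M N : ℕ → ℝ} {B : ℝ} (hB : 0 ≤ B) (h0 : ∀ p, 1 ≤ p → 0 ≤ M p / N p)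
    (h : ∀ p, 1 ≤ p → M p / N p ≤ B ^ p) : Preceq M N := by
  refine ⟨B, fun p hp => ?_⟩
  calc (M p / N p) ^ ((1 : ℝ) / p) ≤ (B ^ p) ^ ((1 : ℝ) / p) :=
        Real.rpow_le_rpow (h0 p hp) (h p hp) (by positivity)
    _ = B := by rw [one_div, Real.pow_rpow_inv_natCast hB (by omega)]

lemma LseqC_nonneg {N : ℕ → ℝ} (hpos : ∀ p, 0 < N p) (s : ℕ) {C : ℝ} (hC : 0 ≤ C) (p : ℕ) :
    0 ≤ LseqC N s C p := by
  unfold LseqC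
  split_ifs
  · exact zero_le_one
  · have hT := tailSum_nonneg hpos p
    refine mul_nonneg (by positivity) (Real.iInf_nonneg fun j => ?_)
    have := (hpos j).le
    positivity

lemma LseqC_le (N : ℕ → ℝ) (s : ℕ) (C : ℝ) {p j : ℕ} (hj : j < p) :
    LseqC N s C p ≤ s ^ p * ((C * p / tailSum N p) ^ (p - j) * N j) := by
  rw [LseqC, if_neg (by omega)]
  refine mul_le_mul_of_nonneg_left ?_ (by positivity)
  exact ciInf_le (Set.finite_range _).bddBelow (⟨j, hj⟩ : Fin p)

lemma le_LseqC {N : ℕ → ℝ} (s : ℕ) {C a : ℝ} {p : ℕ} (hp : 1 ≤ p)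
    (h : ∀ j < p, a ≤ (C * p / tailSum N p) ^ (p - j) * N j) : s ^ p * a ≤ LseqC N s C p := by
  have : Nonempty (Fin p) := ⟨⟨0, hp⟩⟩
  rw [LseqC, if_neg (by omega)]
  exact mul_le_mul_of_nonneg_left (le_ciInf fun j => h j j.2) (by positivity)

/-- If the series of reciprocal quotients diverges then `tailSum N p` has the junk value `0`,
and so has `LseqC N s C p`. -/
lemma LseqC_eq_zero {N : ℕ → ℝ} (hpos : ∀ p, 0 < N p) (s : ℕ) {C : ℝ} (hC : 0 ≤ C) {p : ℕ}
    (hp : 1 ≤ p) (hT : tailSum N p = 0) : LseqC N s C p = 0 := by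
  refine le_antisymm ((LseqC_le N s C hp).trans_eq ?_) (LseqC_nonneg hpos s hC p)
  rw [hT, div_zero, zero_pow (by omega), zero_mul, mul_zero]

lemma LseqC_preceq {N : ℕ → ℝ} (hpos : ∀ p, 0 < N p) (s : ℕ) {C : ℝ} (hC : 1 ≤ C) :
    Preceq (LseqC N s C) N := by
  have hC0 : 0 ≤ C := zero_le_one.trans hC
  refine preceq_of_div_le_pow (B := s * (C * 2)) (by positivity)
    (fun p _ => div_nonneg (LseqC_nonneg hpos s hC0 p) (hpos p).le) fun p hp => ?_
  by_cases hT : tailSum N p = 0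
  · rw [LseqC_eq_zero hpos s hC0 hp hT, zero_div]
    positivity
  have hTpos : 0 < tailSum N p := (tailSum_nonneg hpos p).lt_of_ne' hT
  have hν := nuq_pos hpos p
  have hinv : 1 / tailSum N p ≤ nuq N p :=
    (one_div_le hν hTpos).1 (one_div_nuq_le_tailSum hpos hT)
  have hNp : nuq N p * N (p - 1) = N p := div_mul_cancel₀ _ (hpos (p - 1)).ne'
  rw [div_le_iff₀ (hpos p)]
  calc LseqC N s C p
      ≤ s ^ p * ((C * p / tailSum N p) ^ (p - (p - 1)) * N (p - 1)) :=
        LseqC_le N s C (by omega)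
    _ = s ^ p * (C * p * (1 / tailSum N p * N (p - 1))) := by
        rw [Nat.sub_sub_self hp]
        ring
    _ ≤ s ^ p * (C ^ p * 2 ^ p * (nuq N p * N (p - 1))) := by
        have := (hpos (p - 1)).le
        have hCp : C ≤ C ^ p := le_self_pow₀ hC (by omega)
        have h2p : (p : ℝ) ≤ 2 ^ p := by exact_mod_cast Nat.lt_two_pow_self.le
        gcongr
    _ = (s * (C * 2)) ^ p * N p := by
        rw [hNp]
        ring

lemma IsLC.preceq_LseqC {N : ℕ → ℝ} (hN : IsLC N) (hγ : Gamma1 N) {s : ℕ} (hs : 1 ≤ s) {C : ℝ}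
    (hC : 1 ≤ C) : Preceq N (LseqC N s C) := by
  have hpos := hN.1
  have hC0 : 0 ≤ C := zero_le_one.trans hC
  obtain ⟨B, hB⟩ := hγ
  set D := max B 1
  have hD1 : 1 ≤ D := le_max_right _ _
  have hD : 0 < D := zero_lt_one.trans_le hD1
  refine preceq_of_div_le_pow hD.le
    (fun p _ => div_nonneg (hpos p).le (LseqC_nonneg hpos s hC0 p)) fun p hp => ?_
  by_cases hT : tailSum N p = 0
  · rw [LseqC_eq_zero hpos s hC0 hp hT, div_zero]
    positivity
  have hTpos : 0 < tailSum N p := (tailSum_nonneg hpos p).lt_of_ne' hT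
  have hp0 : (0 : ℝ) < p := by exact_mod_cast hp
  have hν : nuq N p ≤ D * (C * p / tailSum N p) := by
    have h : nuq N p / p * tailSum N p ≤ D := (hB p hp).trans (le_max_left _ _)
    have h' : nuq N p * tailSum N p ≤ D * p := by
      rwa [div_mul_eq_mul_div, div_le_iff₀ hp0] at h
    rw [← mul_div_assoc, le_div_iff₀ hTpos]
    refine h'.trans (mul_le_mul_of_nonneg_left ?_ hD.le)
    exact le_mul_of_one_le_left hp0.le hC
  have hlow : N p / D ^ p ≤ LseqC N s C p := by
    have hNp := (hpos p).le
    refine le_trans ?_ (le_LseqC (a := N p / D ^ p) s hp fun j hj => ?_)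
    · exact le_mul_of_one_le_left (by positivity) (one_le_pow₀ (by exact_mod_cast hs))
    · have hj0 := (hpos j).le
      have hkey := hN.le_nuq_pow_mul j (p - j)
      rw [Nat.add_sub_cancel' hj.le] at hkey
      rw [div_le_iff₀ (by positivity)]
      calc N p ≤ nuq N p ^ (p - j) * N j := hkey
        _ ≤ (D * (C * p / tailSum N p)) ^ (p - j) * N j := by
            have := (nuq_pos hpos p).le
            gcongr
        _ = D ^ (p - j) * ((C * p / tailSum N p) ^ (p - j) * N j) := by ring
        _ ≤ D ^ p * ((C * p / tailSum N p) ^ (p - j) * N j) := by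
            gcongr
            omega
        _ = (C * p / tailSum N p) ^ (p - j) * N j * D ^ p := mul_comm _ _
  have hL : 0 < LseqC N s C p := (div_pos (hpos p) (by positivity)).trans_le hlow
  rw [div_le_iff₀ (by positivity)] at hlow
  rw [div_le_iff₀ hL]
  linarith

theorem stmt4 (N : ℕ → ℝ) (hN : IsLC N) (hγ : Gamma1 N) :
    ∀ s : ℕ, 1 ≤ s → ∀ C : ℝ, 1 ≤ C → SeqEquiv N (LseqC N s C) := by
  intro s hs C hC
  exact ⟨hN.preceq_LseqC hγ hs hC, LseqC_preceq hN.1 s hC⟩
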